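/- The pathwise least-square-Monte-Carlo reformulation of the dynamic program is exact when the true continuation values are used: define C_i := E[U_{i+1} | F_i] for 0 ≤ i < N, and define pathwise W_N := Z_N and W_i := 1{Z_i ≥ C_i} · Z_i + 1{Z_i < C_i} · W_{i+1} for 0 ≤ i < N. Then E[W_i | F_i] = U_i almost surely for every 0 ≤ i ≤ N; in particular E[W_0] = E[U_0] (Equation (asian_ls) of the paper with exact continuation values and unit discount). -/

import Mathlib

open MeasureTheory

/-- A piecewise function over an `m₀`-measurable set, whose first branch is `m₀`-measurable, has
conditional expectation given by conditioning its second branch. -/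
theorem condExp_piecewise_of_stronglyMeasurable {Ω : Type*} {m₀ m : MeasurableSpace Ω}
    {μ : Measure Ω} [IsFiniteMeasure μ] (hm : m₀ ≤ m) {s : Set Ω} [DecidablePred (· ∈ s)]
    (hs : MeasurableSet[m₀] s) {f g : Ω → ℝ} (hf : StronglyMeasurable[m₀] f)
    (hfi : Integrable f μ) (hgi : Integrable g μ) :
    μ[s.piecewise f g | m₀] =ᵐ[μ] s.piecewise f (μ[g | m₀]) := by
  have h_split (g : Ω → ℝ) : s.piecewise f g = s.indicator f + sᶜ.indicator g := by
    classical
    ext ω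
    by_cases h : ω ∈ s <;> simp [h]
  rw [h_split g, h_split (μ[g | m₀])]
  have h_add := condExp_add (hfi.indicator (hm s hs)) (hgi.indicator (hm _ hs.compl)) m₀
  have h_left : μ[s.indicator f | m₀] = s.indicator f :=
    condExp_of_stronglyMeasurable hm (hf.indicator hs) (hfi.indicator (hm s hs))
  have h_right := condExp_indicator hgi hs.compl
  filter_upwards [h_add, h_right] with ω h₁ h₂
  rw [h₁, Pi.add_apply, Pi.add_apply, h_left, h₂]

/-- The pathwise least-square-Monte-Carlo reformulation of the dynamic program
is exact when the true continuation values `C_i := E[U_{i+1} | F_i]` are used: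
with `W_N := Z_N` and `W_i := 1{Z_i ≥ C_i}·Z_i + 1{Z_i < C_i}·W_{i+1}`,
one has `E[W_i | F_i] = U_i` a.s. for every `0 ≤ i ≤ N`; in particular
`E[W_0] = E[U_0]`. -/
theorem lsmc_pathwise_reformulation_exact
    {Ω : Type*} {m : MeasurableSpace Ω} {μ : Measure Ω} [IsProbabilityMeasure μ]
    (N : ℕ) (ℱ : MeasureTheory.Filtration ℕ m) (Z U W : ℕ → Ω → ℝ)
    (hZadp : ∀ i ≤ N, StronglyMeasurable[ℱ i] (Z i))
    (hZint : ∀ i ≤ N, Integrable (Z i) μ)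
    (hUN : U N = Z N)
    (hUrec : ∀ i < N, U i = fun ω => max (Z i ω) ((μ[U (i + 1) | ℱ i]) ω))
    (hWN : W N = Z N)
    (hWrec : ∀ i < N, W i = fun ω =>
      if Z i ω ≥ (μ[U (i + 1) | ℱ i]) ω then Z i ω else W (i + 1) ω) :
    (∀ i ≤ N, μ[W i | ℱ i] =ᵐ[μ] U i) ∧
    ∫ ω, W 0 ω ∂μ = ∫ ω, U 0 ω ∂μ := by
  classical
  have key : ∀ i ≤ N, Integrable (W i) μ ∧ μ[W i | ℱ i] =ᵐ[μ] U i := by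
    intro i hi
    induction hi using Nat.decreasingInduction with
    | self =>
      rw [hWN, hUN, condExp_of_stronglyMeasurable (ℱ.le N) (hZadp N le_rfl) (hZint N le_rfl)]
      exact ⟨hZint N le_rfl, Filter.EventuallyEq.rfl⟩
    | of_succ i hi ih =>
      obtain ⟨h_int, h_eq⟩ := ih
      have hU := hUrec i hi
      have hWi := hWrec i hi
      set C := μ[U (i + 1) | ℱ i]
      have hs : MeasurableSet[ℱ i] {ω | C ω ≤ Z i ω} :=
        stronglyMeasurable_condExp.measurableSet_le (hZadp i hi.le)
      have hW : W i = {ω | C ω ≤ Z i ω}.piecewise (Z i) (W (i + 1)) := by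
        rw [hWi]
        ext ω
        simp [Set.piecewise]
      have h_tower : μ[W (i + 1) | ℱ i] =ᵐ[μ] C :=
        (condExp_condExp_of_le (ℱ.mono i.le_succ) (ℱ.le (i + 1))).symm.trans
          (condExp_congr_ae h_eq)
      refine ⟨?_, ?_⟩
      · rw [hW]
        exact Integrable.piecewise (ℱ.le i _ hs) (hZint i hi.le).integrableOn
          h_int.integrableOn
      · rw [hW, hU]
        filter_upwards [condExp_piecewise_of_stronglyMeasurable (ℱ.le i) hs (hZadp i hi.le)
          (hZint i hi.le) h_int, h_tower] with ω h₁ h₂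
        rw [h₁]
        by_cases h : C ω ≤ Z i ω
        · simp [Set.piecewise, h]
        · simp [Set.piecewise, h, h₂, (not_le.mp h).le]
  refine ⟨fun i hi => (key i hi).2, ?_⟩
  rw [← integral_condExp (ℱ.le 0)]
  exact integral_congr_ae (key 0 N.zero_le).2
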